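/- Let n, p, d be positive natural numbers, let U be an n×n real diagonal matrix with strictly positive diagonal entries, let A be a p×p real positive definite matrix, and let X ∈ ℝ^{n×p}, B ∈ ℝ^{p×d}, Y ∈ ℝ^{n×d}. Define Ω = (X^⊤ U X + A^{-1})^{-1} and Γ = Ω (X^⊤ U Y + A^{-1} B). Then B^⊤ A^{-1} B + Y^⊤ U Y − Γ^⊤ Ω^{-1} Γ = (X B − Y)^⊤ (U^{-1} + X A X^⊤)^{-1} (X B − Y). -/

import Mathlib

open Matrix

/-- Two quadratic terms combine into one after completing the square, where `P` plays the role
of the inverse of `A` and `W` that of the inverse of `Xᵀ * U * X + P`. -/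
theorem Matrix.quadratic_sub_eq_residual {m k l R : Type*} [Fintype m] [Fintype k] [DecidableEq k]
    [CommRing R] {U : Matrix m m R} {P W : Matrix k k R} (hU : Uᵀ = U) (hP : Pᵀ = P)
    (X : Matrix m k R) (B : Matrix k l R) (Y : Matrix m l R)
    (hMW : (Xᵀ * U * X + P) * W = 1) (hWM : W * (Xᵀ * U * X + P) = 1) :
    Bᵀ * P * B + Yᵀ * U * Y - (Xᵀ * U * Y + P * B)ᵀ * W * (Xᵀ * U * Y + P * B) =
      (X * B - Y)ᵀ * (U - U * X * W * Xᵀ * U) * (X * B - Y) := by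
  set M := Xᵀ * U * X + P with hM
  set c := Xᵀ * U * Y + P * B with hc
  have hMt : Mᵀ = M := by
    simp [hM, Matrix.transpose_mul, hU, hP, Matrix.mul_assoc]
  have hr : Xᵀ * U * (X * B - Y) = M * B - c := by
    rw [hM, hc]
    simp only [Matrix.mul_sub, Matrix.add_mul, Matrix.mul_assoc]
    abel
  have hl : (X * B - Y)ᵀ * U * X = Bᵀ * M - cᵀ := by
    have h := congrArg Matrix.transpose hr
    simpa [Matrix.transpose_mul, hU, hMt, Matrix.mul_assoc] using h
  have hq : (Bᵀ * M - cᵀ) * W * (M * B - c) =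
      Bᵀ * M * B - Bᵀ * c - cᵀ * B + cᵀ * W * c := by
    have h₁ : Bᵀ * M * W = Bᵀ := by rw [Matrix.mul_assoc, hMW, Matrix.mul_one]
    have h₂ : cᵀ * W * (M * B) = cᵀ * B := by
      rw [Matrix.mul_assoc, ← Matrix.mul_assoc W, hWM, Matrix.one_mul]
    rw [Matrix.sub_mul, h₁, Matrix.sub_mul, Matrix.mul_sub, Matrix.mul_sub, h₂,
      ← Matrix.mul_assoc]
    abel
  have hs : (X * B - Y)ᵀ * (U - U * X * W * Xᵀ * U) * (X * B - Y) =
      (X * B - Y)ᵀ * U * (X * B - Y) -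
        ((X * B - Y)ᵀ * U * X) * W * (Xᵀ * U * (X * B - Y)) := by
    simp only [Matrix.mul_sub (X * B - Y)ᵀ, Matrix.sub_mul _ _ (X * B - Y), Matrix.mul_assoc]
  have hct : cᵀ * B = Yᵀ * U * X * B + Bᵀ * P * B := by
    simp [hc, Matrix.transpose_mul, hU, hP, Matrix.mul_assoc, Matrix.add_mul]
  have hcr : Bᵀ * c = Bᵀ * Xᵀ * U * Y + Bᵀ * P * B := by
    simp only [hc, Matrix.mul_add, Matrix.mul_assoc]
  rw [hs, hl, hr, hq, hct, hcr, hM]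
  simp only [Matrix.transpose_sub, Matrix.transpose_mul, Matrix.sub_mul, Matrix.mul_sub,
    Matrix.add_mul, Matrix.mul_add, Matrix.mul_assoc]
  abel

theorem stmt_2 (n p d : ℕ) (hn : 0 < n) (hp : 0 < p) (hd : 0 < d)
    (u : Fin n → ℝ) (hu : ∀ i, 0 < u i)
    (U : Matrix (Fin n) (Fin n) ℝ) (hU : U = Matrix.diagonal u)
    (A : Matrix (Fin p) (Fin p) ℝ) (hA : A.PosDef)
    (X : Matrix (Fin n) (Fin p) ℝ) (B : Matrix (Fin p) (Fin d) ℝ)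
    (Y : Matrix (Fin n) (Fin d) ℝ)
    (Ω : Matrix (Fin p) (Fin p) ℝ) (hΩ : Ω = (Xᵀ * U * X + A⁻¹)⁻¹)
    (Γ : Matrix (Fin p) (Fin d) ℝ) (hΓ : Γ = Ω * (Xᵀ * U * Y + A⁻¹ * B)) :
    Bᵀ * A⁻¹ * B + Yᵀ * U * Y - Γᵀ * Ω⁻¹ * Γ =
      (X * B - Y)ᵀ * (U⁻¹ + X * A * Xᵀ)⁻¹ * (X * B - Y) := by
  have hUpd : U.PosDef := hU ▸ Matrix.PosDef.diagonal hu
  have hUt : Uᵀ = U := by rw [hU, Matrix.diagonal_transpose]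
  have hAt : (A⁻¹)ᵀ = A⁻¹ := by
    simpa [Matrix.IsHermitian, Matrix.conjTranspose_eq_transpose_of_trivial] using
      hA.inv.isHermitian
  have hMpd : (Xᵀ * U * X + A⁻¹).PosDef := by
    have h := hUpd.posSemidef.conjTranspose_mul_mul_same X
    rw [Matrix.conjTranspose_eq_transpose_of_trivial] at h
    exact Matrix.PosDef.posSemidef_add h hA.inv
  have hdet := (Matrix.isUnit_iff_isUnit_det _).mp hMpd.isUnit
  have hUdet := (Matrix.isUnit_iff_isUnit_det _).mp hUpd.isUnit
  have hWt : Ωᵀ = Ω := by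
    rw [hΩ, Matrix.transpose_nonsing_inv]
    simp [Matrix.transpose_mul, hUt, hAt, Matrix.mul_assoc]
  have hMW : (Xᵀ * U * X + A⁻¹) * Ω = 1 := hΩ ▸ Matrix.mul_nonsing_inv _ hdet
  have hWM : Ω * (Xᵀ * U * X + A⁻¹) = 1 := hΩ ▸ Matrix.nonsing_inv_mul _ hdet
  have hUinv : U⁻¹⁻¹ = U := Matrix.nonsing_inv_nonsing_inv U hUdet
  have hwood : (U⁻¹ + X * A * Xᵀ)⁻¹ = U - U * X * Ω * Xᵀ * U := by
    rw [Matrix.add_mul_mul_inv_eq_sub _ _ _ _ hUpd.inv.isUnit hA.isUnit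
      (by rw [hUinv, add_comm]; exact hMpd.isUnit), hUinv, hΩ, add_comm A⁻¹]
  have hΓΩ : Γᵀ * Ω⁻¹ * Γ =
      (Xᵀ * U * Y + A⁻¹ * B)ᵀ * Ω * (Xᵀ * U * Y + A⁻¹ * B) := by
    rw [hΓ, Matrix.transpose_mul, hWt, Matrix.mul_assoc _ Ω Ω⁻¹,
      Matrix.mul_nonsing_inv Ω ((Matrix.isUnit_iff_isUnit_det _).mp
        ⟨⟨Ω, _, hWM, hMW⟩, rfl⟩), Matrix.mul_one, ← Matrix.mul_assoc]
  rw [hwood, hΓΩ]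
  exact Matrix.quadratic_sub_eq_residual hUt hAt X B Y hMW hWM
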